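/- Let p ≥ 0 be an integer and let κ* > 0 satisfy J_p(κ*) = 0 and J_p'(κ*) ≠ 0. Let n* > 0 with n* ≠ 1 be such that J_p(√n*·κ*) = 0 and J_p'(√n*·κ*) ≠ 0 (for instance n* = (κ**/κ*)² for any other positive zero κ** of J_p). Then there exist ε > 0 and continuous functions κ̃ : (n*−ε, n*+ε) → ℝ and κ_c : (n*−ε, n*+ε) → ℂ such that: F_p(κ̃(n), n) = 0 and F_p(κ_c(n), n) = 0 = F_p(conj(κ_c(n)), n) for all n; κ̃(n*) = κ* = κ_c(n*); and Im κ_c(n) ≠ 0 for every n ≠ n*. In particular, for every n ≠ n* in (n*−ε, n*+ε) there exist both a real ITE and a complex-conjugated pair of non-real ITEs of the unit disk with angular order p converging to κ* as n → n*. -/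

import Mathlib

open Complex Real Filter Set

/-- Bessel function of the first kind of integer order `p`. -/
noncomputable def besselJ (p : ℕ) (z : ℂ) : ℂ :=
  ∑' m : ℕ, ((-1 : ℂ) ^ m / ((Nat.factorial m : ℂ) * (Nat.factorial (m + p) : ℂ)))
    * (z / 2) ^ (2 * m + p)

/-- Derivative of the Bessel function. -/
noncomputable def besselJ' (p : ℕ) (z : ℂ) : ℂ := deriv (besselJ p) z

/-- The ITE determinant function `F_p(κ, n)`. -/
noncomputable def Fp (p : ℕ) (κ : ℂ) (n : ℝ) : ℂ :=
  κ * (besselJ' p κ * besselJ p ((Real.sqrt n : ℂ) * κ)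
    - (Real.sqrt n : ℂ) * besselJ p κ * besselJ' p ((Real.sqrt n : ℂ) * κ))


/-- The entire function `∑ xᵐ / (m! (m + p)!)`; `besselJ p z` is `(z / 2) ^ p` times its value
at `-z² / 4`. -/
noncomputable def besselSeries (p : ℕ) (x : ℂ) : ℂ :=
  ∑' m : ℕ, x ^ m / ((Nat.factorial m : ℂ) * (Nat.factorial (m + p) : ℂ))

lemma norm_besselSeries_term_le (p m : ℕ) {x : ℂ} {R : ℝ} (hx : ‖x‖ ≤ R) :
    ‖x ^ m / ((Nat.factorial m : ℂ) * (Nat.factorial (m + p) : ℂ))‖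
      ≤ R ^ m / (Nat.factorial m : ℝ) := by
  have h1 : (0 : ℝ) < Nat.factorial m := by exact_mod_cast Nat.factorial_pos m
  have h2 : (1 : ℝ) ≤ Nat.factorial (m + p) := by
    exact_mod_cast Nat.succ_le_of_lt (Nat.factorial_pos (m + p))
  rw [norm_div, norm_mul, norm_pow, Complex.norm_natCast, Complex.norm_natCast]
  have hR : ‖x‖ ^ m ≤ R ^ m := by gcongr
  have hR0 : 0 ≤ R ^ m := le_trans (by positivity) hR
  exact div_le_div₀ hR0 hR h1 (by nlinarith)

lemma summable_besselSeries (p : ℕ) (x : ℂ) :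
    Summable fun m : ℕ => x ^ m / ((Nat.factorial m : ℂ) * (Nat.factorial (m + p) : ℂ)) :=
  (Real.summable_pow_div_factorial ‖x‖).of_norm_bounded
    fun m => norm_besselSeries_term_le p m le_rfl

lemma hasDerivAt_besselSeries (p : ℕ) (x : ℂ) :
    HasDerivAt (besselSeries p) (besselSeries (p + 1) x) x := by
  set U : Set ℂ := Metric.ball 0 (‖x‖ + 1)
  have hxU : x ∈ U := by simp [U]
  have hU : IsOpen U := Metric.isOpen_ball
  have hu := Real.summable_pow_div_factorial (‖x‖ + 1)
  have hle : ∀ m : ℕ, ∀ w ∈ U,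
      ‖w ^ m / ((Nat.factorial m : ℂ) * (Nat.factorial (m + p) : ℂ))‖
        ≤ (‖x‖ + 1) ^ m / (Nat.factorial m : ℝ) := fun m w hw =>
    norm_besselSeries_term_le p m (mem_ball_zero_iff.1 hw).le
  have hd : ∀ m : ℕ, DifferentiableOn ℂ
      (fun w : ℂ => w ^ m / ((Nat.factorial m : ℂ) * (Nat.factorial (m + p) : ℂ))) U :=
    fun m => by fun_prop
  have hs := Complex.hasSum_deriv_of_summable_norm hu hd hU hle hxU
  have hdiff : DifferentiableAt ℂ (besselSeries p) x :=
    (Complex.differentiableOn_tsum_of_summable_norm hu hd hU hle).differentiableAt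
      (hU.mem_nhds hxU)
  have hterm : ∀ m : ℕ,
      deriv (fun w : ℂ => w ^ (m + 1) /
        ((Nat.factorial (m + 1) : ℂ) * (Nat.factorial (m + 1 + p) : ℂ))) x
        = x ^ m / ((Nat.factorial m : ℂ) * (Nat.factorial (m + (p + 1)) : ℂ)) := by
    intro m
    have h1 : (Nat.factorial m : ℂ) ≠ 0 := by exact_mod_cast Nat.factorial_ne_zero m
    have h2 : (Nat.factorial (m + (p + 1)) : ℂ) ≠ 0 := by
      exact_mod_cast Nat.factorial_ne_zero _
    have h3 : ((m : ℂ) + 1) ≠ 0 := by exact_mod_cast Nat.succ_ne_zero m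
    rw [deriv_div_const, deriv_pow_field, show m + 1 + p = m + (p + 1) by ring,
      Nat.factorial_succ]
    push_cast
    field_simp
  have hsum := hs.tsum_eq
  rw [hs.summable.tsum_eq_zero_add] at hsum
  simp only [hterm] at hsum
  have : besselSeries (p + 1) x = deriv (besselSeries p) x := by
    simp only [pow_zero, deriv_const, zero_add] at hsum
    exact hsum
  rw [this]
  exact hdiff.hasDerivAt

lemma besselSeries_recurrence (p : ℕ) (x : ℂ) :
    x * besselSeries (p + 2) x + (p + 1) * besselSeries (p + 1) x = besselSeries p x := by
  have h1 := (summable_besselSeries (p + 1) x).mul_left ((p : ℂ) + 1)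
  have h2 := (summable_besselSeries (p + 2) x).mul_left x
  unfold besselSeries
  rw [← tsum_mul_left, ← tsum_mul_left, (summable_besselSeries p x).tsum_eq_zero_add,
    h1.tsum_eq_zero_add, add_left_comm, ← h2.tsum_add ((summable_nat_add_iff 1).2 h1)]
  congr 1
  · have h4 : (Nat.factorial p : ℂ) ≠ 0 := by exact_mod_cast Nat.factorial_ne_zero p
    have h3 : ((p : ℂ) + 1) ≠ 0 := by exact_mod_cast Nat.succ_ne_zero p
    simp only [pow_zero, Nat.factorial_zero, zero_add, Nat.factorial_succ]
    push_cast
    field_simp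
  · refine tsum_congr fun m => ?_
    have h1 : (Nat.factorial m : ℂ) ≠ 0 := by exact_mod_cast Nat.factorial_ne_zero m
    have h2 : (Nat.factorial (m + p + 1) : ℂ) ≠ 0 := by
      exact_mod_cast Nat.factorial_ne_zero _
    have h3 : ((m : ℂ) + 1) ≠ 0 := by exact_mod_cast Nat.succ_ne_zero m
    have h5 : ((m : ℂ) + p + 1 + 1) ≠ 0 := by exact_mod_cast Nat.succ_ne_zero (m + p + 1)
    rw [show m + (p + 2) = (m + p + 1) + 1 by ring,
      show m + 1 + (p + 1) = (m + p + 1) + 1 by ring, show m + 1 + p = m + p + 1 by ring,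
      Nat.factorial_succ (m + p + 1), Nat.factorial_succ m]
    push_cast
    field_simp
    ring

lemma besselJ_eq_besselSeries (p : ℕ) (z : ℂ) :
    besselJ p z = (z / 2) ^ p * besselSeries p (-(z ^ 2 / 4)) := by
  unfold besselJ besselSeries
  rw [← tsum_mul_left]
  refine tsum_congr fun m => ?_
  rw [pow_add, pow_mul, show -(z ^ 2 / 4) = (-1) * (z / 2) ^ 2 by ring, mul_pow]
  ring

lemma hasDerivAt_besselSeries_comp (p : ℕ) (z : ℂ) :
    HasDerivAt (fun z : ℂ => besselSeries p (-(z ^ 2 / 4)))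
      (besselSeries (p + 1) (-(z ^ 2 / 4)) * (-(z / 2))) z := by
  have h : HasDerivAt (fun z : ℂ => -(z ^ 2 / 4)) (-(z / 2)) z := by
    exact ((hasDerivAt_pow 2 z).div_const 4).neg.congr_deriv (by norm_num; ring)
  exact (hasDerivAt_besselSeries p _).comp z h

lemma mul_deriv_half_pow (p : ℕ) (z : ℂ) :
    ∃ d, HasDerivAt (fun z : ℂ => (z / 2) ^ p) d z ∧ z * d = p * (z / 2) ^ p := by
  refine ⟨_, ((hasDerivAt_id z).div_const 2).pow p, ?_⟩
  cases p with
  | zero => simp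
  | succ p =>
    simp only [id, Nat.add_sub_cancel]
    ring

lemma differentiable_besselJ (p : ℕ) : Differentiable ℂ (besselJ p) := by
  intro z
  obtain ⟨d, hd, -⟩ := mul_deriv_half_pow p z
  exact ((hd.mul (hasDerivAt_besselSeries_comp p z)).congr_of_eventuallyEq
    (.of_forall (besselJ_eq_besselSeries p))).differentiableAt

lemma mul_besselJ' (p : ℕ) (z : ℂ) :
    z * besselJ' p z = p * ((z / 2) ^ p * besselSeries p (-(z ^ 2 / 4)))
      - 2 * ((z / 2) ^ (p + 2) * besselSeries (p + 1) (-(z ^ 2 / 4))) := by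
  obtain ⟨d, hd, hzd⟩ := mul_deriv_half_pow p z
  have h := (hd.mul (hasDerivAt_besselSeries_comp p z)).congr_of_eventuallyEq
    (.of_forall (besselJ_eq_besselSeries p))
  rw [besselJ', h.deriv]
  linear_combination besselSeries p (-(z ^ 2 / 4)) * hzd

/-- Bessel's equation in the form `z (z J_p')' = (p² - z²) J_p`. -/
lemma hasDerivAt_mul_besselJ' (p : ℕ) {z : ℂ} (hz : z ≠ 0) :
    HasDerivAt (fun z => z * besselJ' p z) (((p : ℂ) ^ 2 - z ^ 2) * besselJ p z / z) z := by
  obtain ⟨d, hd, hzd⟩ := mul_deriv_half_pow p z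
  obtain ⟨e, he, hze⟩ := mul_deriv_half_pow (p + 2) z
  have h := (((hd.mul (hasDerivAt_besselSeries_comp p z)).const_mul (p : ℂ)).sub
    ((he.mul (hasDerivAt_besselSeries_comp (p + 1) z)).const_mul 2)).congr_of_eventuallyEq
    (.of_forall (mul_besselJ' p))
  refine h.congr_deriv (Eq.symm ?_)
  rw [div_eq_iff hz, besselJ_eq_besselSeries]
  have hr := besselSeries_recurrence p (-(z ^ 2 / 4))
  push_cast at hze
  linear_combination (-(p : ℂ) * besselSeries p (-(z ^ 2 / 4))) * hzd
    + (2 * besselSeries (p + 1) (-(z ^ 2 / 4))) * hze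
    + z ^ 2 * (z / 2) ^ p * hr

lemma hasDerivAt_besselJ (p : ℕ) (z : ℂ) : HasDerivAt (besselJ p) (besselJ' p z) z :=
  (differentiable_besselJ p z).hasDerivAt

lemma besselJ_conj (p : ℕ) (z : ℂ) :
    besselJ p (starRingEnd ℂ z) = starRingEnd ℂ (besselJ p z) := by
  unfold besselJ
  rw [Complex.conj_tsum]
  simp [map_ofNat (starRingEnd ℂ) 2]

lemma besselJ'_conj (p : ℕ) (z : ℂ) :
    besselJ' p (starRingEnd ℂ z) = starRingEnd ℂ (besselJ' p z) := by
  have h := (hasDerivAt_besselJ p z).conj_conj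
  rw [show (starRingEnd ℂ ∘ besselJ p ∘ starRingEnd ℂ) = besselJ p from
    funext fun w => by simp [besselJ_conj]] at h
  exact h.deriv

open scoped Topology

lemma tendsto_conj_nhds (a : ℂ) :
    Tendsto (starRingEnd ℂ) (𝓝 a) (𝓝 (starRingEnd ℂ a)) :=
  Complex.continuous_conj.tendsto a

/-- The local inverse of an analytic function commuting with conjugation commutes with
conjugation. -/
lemma AnalyticAt.exists_conj_equivariant_inverse {f : ℂ → ℂ} {a : ℂ}
    (ha : starRingEnd ℂ a = a) (hf : AnalyticAt ℂ f a) (hfa : f a = 0) (hf' : deriv f a ≠ 0)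
    (hconj : ∀ᶠ z in 𝓝 a, f (starRingEnd ℂ z) = starRingEnd ℂ (f z)) :
    ∃ g : ℂ → ℂ, AnalyticAt ℂ g 0 ∧ g 0 = a ∧ (∀ᶠ ζ in 𝓝 0, f (g ζ) = ζ) ∧
      ∀ᶠ ζ in 𝓝 0, g (starRingEnd ℂ ζ) = starRingEnd ℂ (g ζ) := by
  have hleft := hf.hasStrictDerivAt.eventually_left_inverse hf'
  have hright := hf.hasStrictDerivAt.eventually_right_inverse hf'
  have hg := hf.analyticAt_localInverse hf'
  set g := hf.hasStrictDerivAt.localInverse f (deriv f a) a hf'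
  have hga : g 0 = a := by simpa [hfa] using hleft.self_of_nhds
  rw [hfa] at hright hg
  refine ⟨g, hg, hga, hright, ?_⟩
  have hgt : Tendsto g (𝓝 0) (𝓝 a) := by simpa [hga] using hg.continuousAt.tendsto
  have hct : Tendsto (fun ζ => starRingEnd ℂ (g ζ)) (𝓝 0) (𝓝 a) := by
    simpa only [ha, Function.comp_def] using (tendsto_conj_nhds a).comp hgt
  filter_upwards [hright, hgt.eventually hconj, hct.eventually hleft] with ζ h1 h2 h3
  rw [← h3, h2, h1]

lemma surjective_cube : Function.Surjective fun x : ℝ => x ^ 3 := by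
  have hnonneg : ∀ k : ℝ, 0 ≤ k → (k ^ ((3 : ℕ) : ℝ)⁻¹) ^ 3 = k := fun k hk =>
    Real.rpow_inv_natCast_pow hk (by norm_num)
  intro k
  rcases le_total 0 k with hk | hk
  · exact ⟨_, hnonneg k hk⟩
  · refine ⟨-((-k) ^ ((3 : ℕ) : ℝ)⁻¹), ?_⟩
    have h := hnonneg (-k) (by linarith)
    simp only
    rw [Odd.neg_pow (by decide), h, neg_neg]

lemma exists_continuous_cube_root : ∃ r : ℝ → ℝ, Continuous r ∧ ∀ x, r x ^ 3 = x := by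
  let e : ℝ ≃o ℝ := StrictMono.orderIsoOfSurjective (fun x : ℝ => x ^ 3)
    (Odd.strictMono_pow (by decide)) surjective_cube
  exact ⟨e.symm, e.symm.continuous, fun x => e.apply_symm_apply x⟩

/-- An analytic function vanishing to order three which commutes with conjugation is locally the
cube of a local coordinate which commutes with conjugation. -/
lemma AnalyticAt.exists_conj_equivariant_cube_root {f : ℂ → ℂ} (hf : AnalyticAt ℂ f 0)
    (hord : analyticOrderAt f 0 = 3)
    (hconj : ∀ᶠ z in 𝓝 0, f (starRingEnd ℂ z) = starRingEnd ℂ (f z)) :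
    ∃ ψ : ℂ → ℂ, AnalyticAt ℂ ψ 0 ∧ ψ 0 = 0 ∧ deriv ψ 0 ≠ 0 ∧ (∀ᶠ z in 𝓝 0, ψ z ^ 3 = f z) ∧
      ∀ᶠ z in 𝓝 0, ψ (starRingEnd ℂ z) = starRingEnd ℂ (ψ z) := by
  obtain ⟨K, hK, hK0, hfK⟩ := (hf.analyticOrderAt_eq_natCast (n := 3)).1 (by exact_mod_cast hord)
  simp only [sub_zero, smul_eq_mul] at hfK
  have hc0 : Tendsto (starRingEnd ℂ) (𝓝 (0 : ℂ)) (𝓝 0) := by simpa using tendsto_conj_nhds 0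
  have hKconj : ∀ᶠ z in 𝓝 0, K (starRingEnd ℂ z) = starRingEnd ℂ (K z) := by
    have hcK : ContinuousAt (fun z => K (starRingEnd ℂ z)) 0 :=
      ContinuousAt.comp (by simpa using hK.continuousAt) Complex.continuous_conj.continuousAt
    have hKc : ContinuousAt (fun z => starRingEnd ℂ (K z)) 0 :=
      Complex.continuous_conj.continuousAt.comp hK.continuousAt
    refine (hcK.eventuallyEq_nhds_iff_eventuallyEq_nhdsNE hKc).1 ?_
    filter_upwards [hconj.filter_mono nhdsWithin_le_nhds, hfK.filter_mono nhdsWithin_le_nhds,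
      (hc0.eventually hfK).filter_mono nhdsWithin_le_nhds, self_mem_nhdsWithin] with z h1 h2 h3 h4
    have h5 : (starRingEnd ℂ z) ^ 3 ≠ 0 := pow_ne_zero 3 (by simpa using h4)
    refine mul_left_cancel₀ h5 ?_
    rw [← h3, h1, h2, map_mul, map_pow]
  obtain ⟨k, hk⟩ := Complex.conj_eq_iff_real.1 (by simpa using hKconj.self_of_nhds.symm)
  obtain ⟨c, hc⟩ : ∃ c : ℝ, c ^ 3 = k := surjective_cube k
  have hc_ne : (c : ℂ) ≠ 0 := by
    rintro h
    apply hK0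
    rw [hk, ← hc]
    push_cast
    simp [h]
  set L : ℂ → ℂ := fun z => (K z / K 0) ^ ((3 : ℕ) : ℂ)⁻¹
  have hquot : AnalyticAt ℂ (fun z => K z / K 0) 0 := hK.div analyticAt_const hK0
  have hslit : K 0 / K 0 ∈ slitPlane := by simp [div_self hK0]
  have hL : AnalyticAt ℂ L 0 := hquot.cpow analyticAt_const hslit
  have hL0 : L 0 = 1 := by simp [L, div_self hK0]
  refine ⟨fun z => c * (z * L z), analyticAt_const.mul (analyticAt_id.mul hL), by simp, ?_, ?_, ?_⟩
  · have h : HasDerivAt (fun z => (c : ℂ) * (z * L z)) (c * (1 * L 0 + 0 * deriv L 0)) 0 :=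
      ((hasDerivAt_id (0 : ℂ)).mul hL.differentiableAt.hasDerivAt).const_mul (c : ℂ)
    rw [h.deriv]
    simpa [hL0] using hc_ne
  · filter_upwards [hfK] with z hz
    have hLz : L z ^ 3 = K z / K 0 := Complex.cpow_nat_inv_pow _ (by norm_num)
    have hc' : (c : ℂ) ^ 3 = K 0 := by rw [hk, ← hc]; push_cast; rfl
    rw [mul_pow, mul_pow, hLz, hc', hz]
    field_simp
  · filter_upwards [hKconj, hquot.continuousAt.eventually_mem (isOpen_slitPlane.mem_nhds hslit)]
      with z h1 h2
    have h3 : L (starRingEnd ℂ z) = starRingEnd ℂ (L z) := by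
      simp only [L]
      rw [h1, hk, ← Complex.conj_ofReal k, ← map_div₀, Complex.conj_ofReal,
        Complex.conj_cpow _ _ (mem_slitPlane_iff_arg.1 (by simpa [hk] using h2)).1]
      simp [map_ofNat (starRingEnd ℂ) 3]
    simp [h3]

lemma hasDerivAt_besselJ_div (p : ℕ) {z : ℂ} (hz : z ≠ 0) (hz' : besselJ' p z ≠ 0) :
    HasDerivAt (fun z => besselJ p z / (z * besselJ' p z))
      ((1 + (z ^ 2 - (p : ℂ) ^ 2) * (besselJ p z / (z * besselJ' p z)) ^ 2) / z) z := by
  refine ((hasDerivAt_besselJ p z).div (hasDerivAt_mul_besselJ' p hz)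
    (mul_ne_zero hz hz')).congr_deriv ?_
  field_simp
  ring

lemma continuous_besselJ' (p : ℕ) : Continuous (besselJ' p) :=
  (differentiable_besselJ p).contDiff.continuous_deriv_one

/-- Near a simple zero `a` of `J_p`, the quotient `ζ = J_p(z) / (z J_p'(z))` is a local coordinate;
its inverse `A` satisfies a Riccati-type equation. -/
lemma exists_besselJ_zero_param (p : ℕ) {a : ℂ} (ha : starRingEnd ℂ a = a) (ha0 : a ≠ 0)
    (hJ : besselJ p a = 0) (hJ' : besselJ' p a ≠ 0) :
    ∃ A : ℂ → ℂ, AnalyticAt ℂ A 0 ∧ A 0 = a ∧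
      (∀ᶠ ζ in 𝓝 0, A (starRingEnd ℂ ζ) = starRingEnd ℂ (A ζ)) ∧
      ∀ᶠ ζ in 𝓝 0, A ζ ≠ 0 ∧ besselJ p (A ζ) / (A ζ * besselJ' p (A ζ)) = ζ ∧
        besselJ' p (A ζ) ≠ 0 ∧ 1 + (A ζ ^ 2 - (p : ℂ) ^ 2) * ζ ^ 2 ≠ 0 ∧
        HasDerivAt A (A ζ / (1 + (A ζ ^ 2 - (p : ℂ) ^ 2) * ζ ^ 2)) ζ := by
  set q : ℂ → ℂ := fun z => besselJ p z / (z * besselJ' p z) with hq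
  have hqa : q a = 0 := by simp [hq, hJ]
  have hne : ∀ᶠ z in 𝓝 a, z ≠ 0 ∧ besselJ' p z ≠ 0 :=
    (eventually_ne_nhds ha0).and ((continuous_besselJ' p).continuousAt.eventually_ne hJ')
  have hqan : AnalyticAt ℂ q a := by
    rw [Complex.analyticAt_iff_eventually_differentiableAt]
    filter_upwards [hne] with z hz
    exact (hasDerivAt_besselJ_div p hz.1 hz.2).differentiableAt
  have hq' : deriv q a ≠ 0 := by
    rw [(hasDerivAt_besselJ_div p ha0 hJ').deriv]
    simp [hJ, ha0]
  have hqconj : ∀ z, q (starRingEnd ℂ z) = starRingEnd ℂ (q z) := by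
    intro z
    simp [hq, besselJ_conj, besselJ'_conj]
  obtain ⟨A, hA, hA0, hqA, hAconj⟩ :=
    hqan.exists_conj_equivariant_inverse ha hqa hq' (.of_forall hqconj)
  refine ⟨A, hA, hA0, hAconj, ?_⟩
  have hAt : Tendsto A (𝓝 0) (𝓝 a) := by simpa [hA0] using hA.continuousAt.tendsto
  have hden : ∀ᶠ ζ in 𝓝 0, 1 + (A ζ ^ 2 - (p : ℂ) ^ 2) * ζ ^ 2 ≠ 0 := by
    have hc := hA.continuousAt
    have : ContinuousAt (fun ζ => 1 + (A ζ ^ 2 - (p : ℂ) ^ 2) * ζ ^ 2) 0 := by fun_prop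
    exact this.eventually_ne (by simp)
  filter_upwards [hAt.eventually hne, hqA.eventually_nhds, hden, hA.eventually_analyticAt]
    with ζ h1 h2 h3 h4
  have h5 : q (A ζ) = ζ := h2.self_of_nhds
  refine ⟨h1.1, h5, h1.2, h3, ?_⟩
  have h6 := (hasDerivAt_besselJ_div p h1.1 h1.2).comp ζ h4.differentiableAt.hasDerivAt
  have h7 := h6.unique ((hasDerivAt_id ζ).congr_of_eventuallyEq h2)
  refine h4.differentiableAt.hasDerivAt.congr_deriv ?_
  change (1 + (A ζ ^ 2 - (p : ℂ) ^ 2) * (q (A ζ)) ^ 2) / A ζ * deriv A ζ = 1 at h7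
  rw [h5] at h7
  have h8 := h1.1
  field_simp at h7 ⊢
  linear_combination h7

lemma Fp_eq_zero {p : ℕ} {κ w ζ : ℂ} {n : ℝ} (hw : w = (Real.sqrt n : ℂ) * κ)
    (hκ0 : κ ≠ 0) (hw0 : w ≠ 0) (hκ' : besselJ' p κ ≠ 0) (hw' : besselJ' p w ≠ 0)
    (hκ : besselJ p κ / (κ * besselJ' p κ) = ζ) (hwζ : besselJ p w / (w * besselJ' p w) = ζ) :
    Fp p κ n = 0 := by
  rw [div_eq_iff (mul_ne_zero hκ0 hκ')] at hκ
  rw [div_eq_iff (mul_ne_zero hw0 hw')] at hwζ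
  rw [Fp, ← hw, hκ, hwζ]
  linear_combination (κ * besselJ' p κ * ζ * besselJ' p w) * hw

lemma Fp_conj (p : ℕ) (κ : ℂ) (n : ℝ) :
    Fp p (starRingEnd ℂ κ) n = starRingEnd ℂ (Fp p κ n) := by
  have h : (Real.sqrt n : ℂ) * starRingEnd ℂ κ = starRingEnd ℂ ((Real.sqrt n : ℂ) * κ) := by simp
  simp only [Fp, h, besselJ_conj, besselJ'_conj]
  simp

/-- In the coordinate `ζ`, the ratio of two zero branches of `J_p` is stationary to second
order. -/
lemma analyticOrderAt_ratio {p : ℕ} {A B : ℂ → ℂ} (hA : AnalyticAt ℂ A 0) (hB : AnalyticAt ℂ B 0)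
    (hA0 : A 0 ≠ 0) (hB0 : B 0 ≠ 0) (hAB : A 0 ^ 2 ≠ B 0 ^ 2)
    (hAd : ∀ᶠ ζ in 𝓝 0, A ζ ≠ 0 ∧ 1 + (A ζ ^ 2 - (p : ℂ) ^ 2) * ζ ^ 2 ≠ 0 ∧
        HasDerivAt A (A ζ / (1 + (A ζ ^ 2 - (p : ℂ) ^ 2) * ζ ^ 2)) ζ)
    (hBd : ∀ᶠ ζ in 𝓝 0, 1 + (B ζ ^ 2 - (p : ℂ) ^ 2) * ζ ^ 2 ≠ 0 ∧
        HasDerivAt B (B ζ / (1 + (B ζ ^ 2 - (p : ℂ) ^ 2) * ζ ^ 2)) ζ) :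
    analyticOrderAt (fun ζ => B ζ / A ζ - B 0 / A 0) 0 = 3 := by
  have hS : AnalyticAt ℂ (fun ζ => B ζ / A ζ) 0 := hB.fun_div hA hA0
  rw [← hS.analyticOrderAt_deriv_add_one]
  suffices analyticOrderAt (deriv fun ζ => B ζ / A ζ) 0 = (2 : ℕ) by
    rw [this]
    norm_num
  rw [hS.deriv.analyticOrderAt_eq_natCast]
  refine ⟨fun ζ => B ζ / A ζ * (A ζ ^ 2 - B ζ ^ 2) /
    ((1 + (A ζ ^ 2 - (p : ℂ) ^ 2) * ζ ^ 2) * (1 + (B ζ ^ 2 - (p : ℂ) ^ 2) * ζ ^ 2)), ?_, ?_, ?_⟩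
  · refine AnalyticAt.fun_div (by fun_prop) (by fun_prop) (by simp)
  · simp [hA0, hB0, sub_eq_zero, hAB]
  · filter_upwards [hAd, hBd] with ζ h1 h2
    obtain ⟨h1, h3, h4⟩ := h1
    obtain ⟨h5, h6⟩ := h2
    rw [(h6.fun_div h4 h1).deriv]
    simp only [sub_zero, smul_eq_mul]
    generalize hX : 1 + (A ζ ^ 2 - (p : ℂ) ^ 2) * ζ ^ 2 = X at h3 ⊢
    generalize hY : 1 + (B ζ ^ 2 - (p : ℂ) ^ 2) * ζ ^ 2 = Y at h5 ⊢
    field_simp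
    rw [← hX, ← hY]
    ring

/-- The solutions of `F_p(κ, n) = 0` near `κs` are parametrized by `τ` with
`τ³ = √n - √nst`, and non-real `τ` correspond to non-real `κ`. -/
lemma exists_trajectory_param (p : ℕ) {κs nst : ℝ} (hκs : 0 < κs)
    (hJ : besselJ p (κs : ℂ) = 0) (hJ' : besselJ' p (κs : ℂ) ≠ 0)
    (hnst : 0 < nst) (hnst1 : nst ≠ 1)
    (hJn : besselJ p ((Real.sqrt nst * κs : ℝ) : ℂ) = 0)
    (hJn' : besselJ' p ((Real.sqrt nst * κs : ℝ) : ℂ) ≠ 0) :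
    ∃ κ : ℂ → ℂ, AnalyticAt ℂ κ 0 ∧ κ 0 = κs ∧
      ∀ᶠ τ in 𝓝 0, κ (starRingEnd ℂ τ) = starRingEnd ℂ (κ τ) ∧
        (∀ n : ℝ, τ ^ 3 = (Real.sqrt n : ℂ) - (Real.sqrt nst : ℂ) → Fp p (κ τ) n = 0) ∧
        (starRingEnd ℂ (κ τ) = κ τ → starRingEnd ℂ τ = τ) := by
  have hs : 0 < Real.sqrt nst := Real.sqrt_pos.2 hnst
  have hκ0 : (κs : ℂ) ≠ 0 := by exact_mod_cast hκs.ne'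
  have hw0 : ((Real.sqrt nst * κs : ℝ) : ℂ) ≠ 0 := by exact_mod_cast (mul_pos hs hκs).ne'
  obtain ⟨A, hA, hA0, hAc, hAd⟩ :=
    exists_besselJ_zero_param p (Complex.conj_ofReal κs) hκ0 hJ hJ'
  obtain ⟨B, hB, hB0, hBc, hBd⟩ :=
    exists_besselJ_zero_param p (Complex.conj_ofReal _) hw0 hJn hJn'
  have hratio : B 0 / A 0 = (Real.sqrt nst : ℂ) := by
    rw [hA0, hB0]
    push_cast
    field_simp
  have hAB : A 0 ^ 2 ≠ B 0 ^ 2 := by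
    rw [hA0, hB0]
    norm_cast
    rw [mul_pow, Real.sq_sqrt hnst.le]
    intro h
    exact hnst1 (mul_right_cancel₀ (pow_pos hκs 2).ne' (by linarith))
  have hord := analyticOrderAt_ratio hA hB (hA0 ▸ hκ0) (hB0 ▸ hw0) hAB
    (hAd.mono fun ζ h => ⟨h.1, h.2.2.2⟩) (hBd.mono fun ζ h => h.2.2.2)
  rw [hratio] at hord
  have hSan : AnalyticAt ℂ (fun ζ => B ζ / A ζ - (Real.sqrt nst : ℂ)) 0 :=
    (hB.fun_div hA (hA0 ▸ hκ0)).fun_sub analyticAt_const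
  have hSc : ∀ᶠ ζ in 𝓝 0, B (starRingEnd ℂ ζ) / A (starRingEnd ℂ ζ) - (Real.sqrt nst : ℂ)
      = starRingEnd ℂ (B ζ / A ζ - (Real.sqrt nst : ℂ)) := by
    filter_upwards [hAc, hBc] with ζ h1 h2
    simp [h1, h2]
  obtain ⟨ψ, hψ, hψ0, hψ', hψS, hψc⟩ := hSan.exists_conj_equivariant_cube_root hord hSc
  obtain ⟨g, hg, hg0, hψg, hgc⟩ :=
    hψ.exists_conj_equivariant_inverse (map_zero _) hψ0 hψ' hψc
  have hgt : Tendsto g (𝓝 0) (𝓝 0) := by simpa [hg0] using hg.continuousAt.tendsto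
  refine ⟨fun τ => A (g τ), AnalyticAt.fun_comp (by rwa [hg0]) hg, by simp [hg0, hA0], ?_⟩
  filter_upwards [hψg, hgc, hgt.eventually hAc, hgt.eventually hAd, hgt.eventually hBd,
    hgt.eventually hψS, hgt.eventually hψc] with τ h1 h2 h3 hAτ hBτ h4 h5
  obtain ⟨hA1, hA2, hA3, -⟩ := hAτ
  obtain ⟨hB1, hB2, hB3, -⟩ := hBτ
  refine ⟨by rw [h2, h3], fun n hn => ?_, fun hreal => ?_⟩
  · refine Fp_eq_zero (w := B (g τ)) ?_ hA1 hB1 hA3 hB3 hA2 hB2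
    rw [h1, hn] at h4
    rw [← div_eq_iff hA1]
    linear_combination -h4
  · have hζ : starRingEnd ℂ (g τ) = g τ := by
      rw [← hA2, map_div₀, map_mul, ← besselJ_conj, ← besselJ'_conj, hreal]
    rw [← h1, ← h5, hζ]

lemma exists_nonreal_cube_root_one : ∃ ω : ℂ, ω ^ 3 = 1 ∧ ω.im ≠ 0 := by
  refine ⟨(-1 + (Real.sqrt 3 : ℝ) * I) / 2, ?_, by simp⟩
  have h : ((Real.sqrt 3 : ℝ) : ℂ) ^ 2 = 3 := by
    norm_cast
    exact Real.sq_sqrt (by norm_num)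
  linear_combination ((Real.sqrt 3 : ℂ) * I ^ 3 / 8 - 3 / 8 * I ^ 2) * h
    + (3 * (Real.sqrt 3 : ℂ) * I / 8 - 9 / 8) * I_sq

/-- existence of a real trajectory and a complex-conjugated pair of non-real
trajectories through an IDE. -/
theorem stmt_15 (p : ℕ) (κs : ℝ) (hκs : 0 < κs)
    (hJ : besselJ p (κs : ℂ) = 0) (hJ' : besselJ' p (κs : ℂ) ≠ 0)
    (nst : ℝ) (hnst : 0 < nst) (hnst1 : nst ≠ 1)
    (hJn : besselJ p ((Real.sqrt nst * κs : ℝ) : ℂ) = 0)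
    (hJn' : besselJ' p ((Real.sqrt nst * κs : ℝ) : ℂ) ≠ 0) :
    ∃ ε > 0, ∃ κt : ℝ → ℝ, ∃ κc : ℝ → ℂ,
      ContinuousOn κt (Set.Ioo (nst - ε) (nst + ε)) ∧
      ContinuousOn κc (Set.Ioo (nst - ε) (nst + ε)) ∧
      (∀ n ∈ Set.Ioo (nst - ε) (nst + ε),
        Fp p ((κt n : ℝ) : ℂ) n = 0 ∧ Fp p (κc n) n = 0 ∧
          Fp p (starRingEnd ℂ (κc n)) n = 0) ∧
      κt nst = κs ∧ κc nst = (κs : ℂ) ∧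
      (∀ n ∈ Set.Ioo (nst - ε) (nst + ε), n ≠ nst → (κc n).im ≠ 0) := by
  obtain ⟨κ, hκ, hκ0, hev⟩ := exists_trajectory_param p hκs hJ hJ' hnst hnst1 hJn hJn'
  obtain ⟨ω, hω, hωim⟩ := exists_nonreal_cube_root_one
  obtain ⟨c, hc, hc3⟩ := exists_continuous_cube_root
  set r : ℝ → ℝ := fun n => c (Real.sqrt n - Real.sqrt nst) with hr
  have hrc : Continuous r := hc.comp (by fun_prop)
  have hr3 : ∀ n, r n ^ 3 = Real.sqrt n - Real.sqrt nst := fun n => hc3 _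
  have hr0 : r nst = 0 := by simpa using hr3 nst
  have hgood := hev.and (hκ.eventually_analyticAt)
  have ht : ∀ a : ℂ, Tendsto (fun n : ℝ => a * (r n : ℂ)) (𝓝 nst) (𝓝 0) := fun a => by
    have : Continuous fun n : ℝ => a * (r n : ℂ) := by fun_prop
    simpa [hr0] using this.tendsto nst
  obtain ⟨ε, hε, hball⟩ := Metric.eventually_nhds_iff_ball.1
    ((((ht 1).eventually hgood).and ((ht ω).eventually hgood)).and (eventually_gt_nhds hnst))
  rw [Real.ball_eq_Ioo] at hball
  have hcont : ∀ a : ℂ, (∀ n ∈ Set.Ioo (nst - ε) (nst + ε), AnalyticAt ℂ κ (a * (r n : ℂ))) →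
      ContinuousOn (fun n : ℝ => κ (a * (r n : ℂ))) (Set.Ioo (nst - ε) (nst + ε)) :=
    fun a ha n hn => (ContinuousAt.comp (f := fun n : ℝ => a * (r n : ℂ)) (ha n hn).continuousAt
      (by fun_prop)).continuousWithinAt
  have hcube : ∀ a : ℂ, a ^ 3 = 1 → ∀ n : ℝ,
      (a * (r n : ℂ)) ^ 3 = (Real.sqrt n : ℂ) - (Real.sqrt nst : ℂ) := fun a ha n => by
    rw [mul_pow, ha, one_mul]
    exact_mod_cast hr3 n
  have hFp : ∀ n ∈ Set.Ioo (nst - ε) (nst + ε), Fp p (κ (ω * (r n : ℂ))) n = 0 := fun n hn =>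
    (hball n hn).1.2.1.2.1 n (hcube ω hω n)
  refine ⟨ε, hε, fun n => (κ (1 * (r n : ℂ))).re, fun n => κ (ω * (r n : ℂ)),
    Complex.continuous_re.comp_continuousOn (hcont 1 fun n hn => (hball n hn).1.1.2),
    hcont ω fun n hn => (hball n hn).1.2.2, fun n hn => ⟨?_, hFp n hn, ?_⟩,
    by simp [hr0, hκ0], by simp [hr0, hκ0], fun n hn hne him => ?_⟩
  · have h := (hball n hn).1.1.1
    have hreal : starRingEnd ℂ (κ (1 * (r n : ℂ))) = κ (1 * (r n : ℂ)) := by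
      rw [← h.1]
      simp
    rw [Complex.conj_eq_iff_re.1 hreal]
    exact h.2.1 n (hcube 1 (one_pow 3) n)
  · rw [Fp_conj, hFp n hn, map_zero]
  · have h := (hball n hn).1.2.1.2.2 (Complex.conj_eq_iff_im.2 him)
    have him' := Complex.conj_eq_iff_im.1 h
    rw [Complex.im_mul_ofReal] at him'
    have hrn : r n = 0 := (mul_eq_zero.1 him').resolve_left hωim
    have h3 := hr3 n
    rw [hrn] at h3
    refine hne ((Real.sqrt_inj (hball n hn).2.le hnst.le).1 ?_)
    linarith
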